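/- Let S > 0 and Z > 0 be the mean service time and mean uptime of a machine-repairman, and let σ = S/(S+Z) and T₁ = S + Z. If the repairman round-trip speedup (S+Z)/(S + Z/p) equals the Amdahl ratio T₁/(σ'T₁ + ((1-σ')/p)T₁) for all real p ≥ 1 with some σ' ∈ [0,1], then S = σ'·T₁, Z = (1-σ')·T₁, hence S = (σ'/(1-σ'))·Z and σ' = S/(S+Z) = σ. Moreover σ → 0 as S → 0 with Z fixed, and σ → 1 as Z → 0 with S fixed. -/

import Mathlib

open Filter Topology

/-- Serial fraction identification: if the repairman round-trip speedup equals the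
Amdahl ratio for all p ≥ 1, then S = σ'T₁, Z = (1-σ')T₁, S = (σ'/(1-σ'))Z and
σ' = S/(S+Z) = σ. Moreover σ = S/(S+Z) → 0 as S → 0⁺ (Z fixed) and → 1 as Z → 0⁺
(S fixed). -/
theorem serial_fraction_identity (S Z σ' : ℝ) (hS : 0 < S) (hZ : 0 < Z)
    (hσ'0 : 0 ≤ σ') (hσ'1 : σ' ≤ 1)
    (h : ∀ p : ℝ, 1 ≤ p →
      (S + Z) / (S + Z / p) =
        (S + Z) / (σ' * (S + Z) + ((1 - σ') / p) * (S + Z))) :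
    S = σ' * (S + Z) ∧ Z = (1 - σ') * (S + Z) ∧
    S = (σ' / (1 - σ')) * Z ∧ σ' = S / (S + Z) ∧
    Tendsto (fun s : ℝ => s / (s + Z)) (𝓝[>] 0) (𝓝 0) ∧
    Tendsto (fun z : ℝ => S / (S + z)) (𝓝[>] 0) (𝓝 1) := by
  have hT : 0 < S + Z := add_pos hS hZ
  have h2 := inv_injective (mul_left_cancel₀ hT.ne' (h 2 one_le_two))
  have hST : S = σ' * (S + Z) := by linarith
  have hZT : Z = (1 - σ') * (S + Z) := by linarith
  have hσ : 0 < 1 - σ' := pos_of_mul_pos_left (hZ.trans_eq hZT) hT.le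
  refine ⟨hST, hZT, ?_, (eq_div_iff hT.ne').mpr hST.symm, ?_, ?_⟩
  · rw [div_mul_eq_mul_div, eq_div_iff hσ.ne']
    linarith
  · have hc : ContinuousAt (fun s : ℝ => s / (s + Z)) 0 :=
      continuousAt_id.div (continuousAt_id.add continuousAt_const) (by simpa using hZ.ne')
    simpa using hc.tendsto.mono_left nhdsWithin_le_nhds
  · have hc : ContinuousAt (fun z : ℝ => S / (S + z)) 0 :=
      continuousAt_const.div (continuousAt_const.add continuousAt_id) (by simpa using hS.ne')
    simpa [hS.ne'] using hc.tendsto.mono_left nhdsWithin_le_nhds
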